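/- arXiv:2107.08829 — 3 statements merged into one kernel-verified Lean document; each statement's English description precedes it below -/
import Mathlib

section
/- Let S and A be finite nonempty types, γ ∈ [0,1), α ≥ 0, R_max ≥ 0. Let ρ_E, ρ_π, ρ̂_π be pmfs on S × A, and let r : S × A → ℝ satisfy 0 ≤ r(s,a) ≤ R_max for all (s,a). Define J_π = (1−γ)⁻¹·∑_{s,a} ρ_π(s,a)·r(s,a) and J_E = (1−γ)⁻¹·∑_{s,a} ρ_E(s,a)·r(s,a). If TV(ρ̂_π, ρ_π) ≤ α/(1−γ), then |J_E − J_π| ≤ (R_max/(1−γ))·TV(ρ̂_π, ρ_E) + α·R_max/(1−γ)². -/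
open Finset

/-- `p` is a probability mass function on the finite type `S`. -/
def IsPmf {S : Type*} [Fintype S] (p : S → ℝ) : Prop :=
  (∀ s, 0 ≤ p s) ∧ ∑ s, p s = 1

/-- Total variation distance between two pmfs on a finite type. -/
noncomputable def TV {S : Type*} [Fintype S] (p q : S → ℝ) : ℝ :=
  (1 / 2) * ∑ s, |p s - q s|

/-- The expectations of a function with values in `[0, M]` under two pmfs differ by at most
`M` times their total variation distance. -/
theorem IsPmf.abs_sum_mul_sub_sum_mul_le {X : Type*} [Fintype X] {p q : X → ℝ}
    (hp : IsPmf p) (hq : IsPmf q) {f : X → ℝ} {M : ℝ} (hf : ∀ x, 0 ≤ f x ∧ f x ≤ M) :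
    |∑ x, p x * f x - ∑ x, q x * f x| ≤ M * TV p q := by
  have hcenter : ∑ x, p x * f x - ∑ x, q x * f x = ∑ x, (p x - q x) * (f x - M / 2) := by
    have hsplit : ∑ x, (p x - q x) * (f x - M / 2) =
        ∑ x, p x * f x - ∑ x, q x * f x - (∑ x, p x - ∑ x, q x) * (M / 2) := by
      simp only [← Finset.sum_sub_distrib, Finset.sum_mul]
      exact Finset.sum_congr rfl fun x _ => by ring
    rw [hsplit, hp.2, hq.2]
    ring
  calc |∑ x, p x * f x - ∑ x, q x * f x|
      = |∑ x, (p x - q x) * (f x - M / 2)| := by rw [hcenter]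
    _ ≤ ∑ x, |(p x - q x) * (f x - M / 2)| := Finset.abs_sum_le_sum_abs _ _
    _ ≤ ∑ x, |p x - q x| * (M / 2) := by
        refine Finset.sum_le_sum fun x _ => ?_
        rw [abs_mul]
        have hx : |f x - M / 2| ≤ M / 2 :=
          abs_le.2 ⟨by linarith [(hf x).1], by linarith [(hf x).2]⟩
        gcongr
    _ = M * TV p q := by
        rw [← Finset.sum_mul, TV]
        ring

/-- Measure-level form of Lemma 1 of the paper. -/
theorem vmail_lemma1_measure_level {S A : Type*} [Fintype S] [Fintype A]
    [Nonempty S] [Nonempty A]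
    (γ α Rmax : ℝ) (hγ0 : 0 ≤ γ) (hγ1 : γ < 1) (hα : 0 ≤ α) (hR : 0 ≤ Rmax)
    (ρE ρπ ρhatπ : S × A → ℝ)
    (hρE : IsPmf ρE) (hρπ : IsPmf ρπ) (hρhatπ : IsPmf ρhatπ)
    (r : S × A → ℝ) (hr : ∀ sa, 0 ≤ r sa ∧ r sa ≤ Rmax)
    (Jπ JE : ℝ)
    (hJπ : Jπ = (1 - γ)⁻¹ * ∑ sa, ρπ sa * r sa)
    (hJE : JE = (1 - γ)⁻¹ * ∑ sa, ρE sa * r sa)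
    (hmodel : TV ρhatπ ρπ ≤ α / (1 - γ)) :
    |JE - Jπ| ≤ (Rmax / (1 - γ)) * TV ρhatπ ρE + α * Rmax / (1 - γ) ^ 2 := by
  subst hJπ hJE
  have hg : 0 < 1 - γ := sub_pos.2 hγ1
  have hE := hρhatπ.abs_sum_mul_sub_sum_mul_le hρE hr
  have hπ := hρhatπ.abs_sum_mul_sub_sum_mul_le hρπ hr
  have hbias := mul_le_mul_of_nonneg_left hmodel hR
  have htri := abs_sub_le (∑ sa, ρE sa * r sa) (∑ sa, ρhatπ sa * r sa) (∑ sa, ρπ sa * r sa)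
  rw [abs_sub_comm (∑ sa, ρE sa * r sa) (∑ sa, ρhatπ sa * r sa)] at htri
  rw [← mul_sub, abs_mul, abs_of_pos (inv_pos.2 hg)]
  calc (1 - γ)⁻¹ * |∑ sa, ρE sa * r sa - ∑ sa, ρπ sa * r sa|
      ≤ (1 - γ)⁻¹ * (Rmax * TV ρhatπ ρE + Rmax * (α / (1 - γ))) :=
        mul_le_mul_of_nonneg_left (by linarith) (inv_pos.2 hg).le
    _ = (Rmax / (1 - γ)) * TV ρhatπ ρE + α * Rmax / (1 - γ) ^ 2 := by
        field_simp
end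

section
/- Let S be a finite nonempty type and α ≥ 0. Let μ₀ be a pmf on S, and let K, K̂ : S → (S → ℝ) assign to each s pmfs K s and K̂ s on S with TV(K s, K̂ s) ≤ α for all s. Define the time-marginals by μ_0 = μ₀, μ_{t+1}(s') = ∑_s μ_t(s)·K s s', and μ̂_0 = μ₀, μ̂_{t+1}(s') = ∑_s μ̂_t(s)·K̂ s s'. Then for every t ∈ ℕ, TV(μ_t, μ̂_t) ≤ t·α. -/
open Finset

/-- A pmf pushed forward through a family of pmfs is a pmf. -/
theorem IsPmf.bind {S : Type*} [Fintype S] {p : S → ℝ} {K : S → S → ℝ}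
    (hp : IsPmf p) (hK : ∀ s, IsPmf (K s)) :
    IsPmf fun s' => ∑ s, p s * K s s' := by
  refine ⟨fun s' => sum_nonneg fun s _ => mul_nonneg (hp.1 s) ((hK s).1 s'), ?_⟩
  rw [sum_comm]
  simp only [← mul_sum, (hK _).2, mul_one, hp.2]

/-- One step of two chains whose kernels are `α`-close increases the total variation distance
by at most `α`. -/
theorem TV_bind_le {S : Type*} [Fintype S] {α : ℝ} {p q : S → ℝ} {K L : S → S → ℝ}
    (hp : IsPmf p) (hL : ∀ s, IsPmf (L s)) (hKL : ∀ s, TV (K s) (L s) ≤ α) :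
    TV (fun s' => ∑ s, p s * K s s') (fun s' => ∑ s, q s * L s s') ≤ TV p q + α := by
  have pointwise (s' : S) : |∑ s, p s * K s s' - ∑ s, q s * L s s'| ≤
      ∑ s, (p s * |K s s' - L s s'| + |p s - q s| * L s s') := by
    rw [← sum_sub_distrib]
    refine (abs_sum_le_sum_abs _ _).trans (sum_le_sum fun s _ => ?_)
    calc |p s * K s s' - q s * L s s'|
        = |p s * (K s s' - L s s') + (p s - q s) * L s s'| := by ring_nf
      _ ≤ |p s * (K s s' - L s s')| + |(p s - q s) * L s s'| := abs_add_le _ _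
      _ = p s * |K s s' - L s s'| + |p s - q s| * L s s' := by
        rw [abs_mul, abs_mul, abs_of_nonneg (hp.1 s), abs_of_nonneg ((hL s).1 s')]
  calc TV (fun s' => ∑ s, p s * K s s') (fun s' => ∑ s, q s * L s s')
      ≤ (1 / 2) * ∑ s', ∑ s, (p s * |K s s' - L s s'| + |p s - q s| * L s s') :=
        mul_le_mul_of_nonneg_left (sum_le_sum fun s' _ => pointwise s') (by norm_num)
    _ = TV p q + ∑ s, p s * TV (K s) (L s) := by
        rw [sum_comm]
        simp only [TV, sum_add_distrib, ← mul_sum, (hL _).2, mul_one, mul_left_comm (p _)]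
        ring
    _ ≤ TV p q + ∑ s, p s * α := by
        gcongr with s _
        · exact hp.1 s
        · exact hKL s
    _ = TV p q + α := by rw [← sum_mul, hp.2, one_mul]

/-- Multi-step simulation bound: the time-t marginals of the true and
model chains differ by at most `t·α` in total variation. -/
theorem tv_multi_step_simulation {S : Type*} [Fintype S] [Nonempty S]
    (α : ℝ) (hα : 0 ≤ α)
    (μ₀ : S → ℝ) (hμ₀ : IsPmf μ₀)
    (K Khat : S → S → ℝ) (hK : ∀ s, IsPmf (K s)) (hKhat : ∀ s, IsPmf (Khat s))
    (hKK : ∀ s, TV (K s) (Khat s) ≤ α)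
    (μ μhat : ℕ → S → ℝ)
    (hμ0 : μ 0 = μ₀) (hμhat0 : μhat 0 = μ₀)
    (hμstep : ∀ t s', μ (t + 1) s' = ∑ s, μ t s * K s s')
    (hμhatstep : ∀ t s', μhat (t + 1) s' = ∑ s, μhat t s * Khat s s') :
    ∀ t : ℕ, TV (μ t) (μhat t) ≤ t * α := by
  have hpmf : ∀ t, IsPmf (μ t) := by
    intro t
    induction t with
    | zero => rwa [hμ0]
    | succ t ih =>
      rw [funext (hμstep t)]
      exact ih.bind hK
  intro t
  induction t with
  | zero => simp [TV, hμ0, hμhat0]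
  | succ t ih =>
    rw [funext (hμstep t), funext (hμhatstep t)]
    have step := TV_bind_le (q := μhat t) (hpmf t) hKhat hKK
    push_cast
    linarith
end

section
/- Let S be a finite nonempty type, γ ∈ [0,1), and α ≥ 0. Let μ₀ be a pmf on S, and let K, K̂ : S → (S → ℝ) assign to each s pmfs K s and K̂ s on S with TV(K s, K̂ s) ≤ α for all s. Define μ_0 = μ₀, μ_{t+1}(s') = ∑_s μ_t(s)·K s s', and μ̂_0 = μ₀, μ̂_{t+1}(s') = ∑_s μ̂_t(s)·K̂ s s', and the discounted visitation distributions ρ(s) = (1−γ)·∑'_{t∈ℕ} γ^t·μ_t(s) and ρ̂(s) = (1−γ)·∑'_{t∈ℕ} γ^t·μ̂_t(s). Then TV(ρ, ρ̂) ≤ α/(1−γ). -/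
open Finset

theorem IsPmf.le_one {S : Type*} [Fintype S] {p : S → ℝ} (hp : IsPmf p) (s : S) : p s ≤ 1 :=
  hp.2 ▸ single_le_sum (fun i _ => hp.1 i) (mem_univ s)

/-- The image of a pmf under a Markov kernel is a pmf. -/
theorem IsPmf.sum_mul {S T : Type*} [Fintype S] [Fintype T] {p : S → ℝ} {K : S → T → ℝ}
    (hp : IsPmf p) (hK : ∀ s, IsPmf (K s)) : IsPmf fun t => ∑ s, p s * K s t := by
  refine ⟨fun t => sum_nonneg fun s _ => mul_nonneg (hp.1 s) ((hK s).1 t), ?_⟩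
  rw [sum_comm]
  simp [← mul_sum, (hK _).2, hp.2]

/-- Pushing two pmfs through two `α`-close Markov kernels increases their total variation
distance by at most `α`. -/
theorem TV_sum_mul_le {S T : Type*} [Fintype S] [Fintype T] {p q : S → ℝ} {K L : S → T → ℝ}
    {α : ℝ} (hp : IsPmf p) (hL : ∀ s, IsPmf (L s)) (hKL : ∀ s, TV (K s) (L s) ≤ α) :
    TV (fun t => ∑ s, p s * K s t) (fun t => ∑ s, q s * L s t) ≤ TV p q + α := by
  have hpoint (t : T) : |∑ s, p s * K s t - ∑ s, q s * L s t| ≤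
      ∑ s, (p s * |K s t - L s t| + |p s - q s| * L s t) := by
    rw [← sum_sub_distrib]
    refine (abs_sum_le_sum_abs _ _).trans (sum_le_sum fun s _ => ?_)
    calc |p s * K s t - q s * L s t|
        = |p s * (K s t - L s t) + (p s - q s) * L s t| := by ring_nf
      _ ≤ |p s * (K s t - L s t)| + |(p s - q s) * L s t| := abs_add_le _ _
      _ = p s * |K s t - L s t| + |p s - q s| * L s t := by
        rw [abs_mul, abs_mul, abs_of_nonneg (hp.1 s), abs_of_nonneg ((hL s).1 t)]
  calc TV (fun t => ∑ s, p s * K s t) (fun t => ∑ s, q s * L s t)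
      ≤ (1 / 2) * ∑ t, ∑ s, (p s * |K s t - L s t| + |p s - q s| * L s t) :=
        mul_le_mul_of_nonneg_left (sum_le_sum fun t _ => hpoint t) (by norm_num)
    _ = TV p q + ∑ s, p s * TV (K s) (L s) := by
        rw [sum_comm]
        simp only [sum_add_distrib, ← mul_sum, (hL _).2, mul_one, TV, mul_left_comm _ (1 / 2 : ℝ)]
        ring
    _ ≤ TV p q + ∑ s, p s * α := by
        gcongr with s
        · exact hp.1 s
        · exact hKL s
    _ = TV p q + α := by rw [← sum_mul, hp.2, one_mul]

theorem IsPmf.summable_geometric_mul {S : Type*} [Fintype S] {γ : ℝ} (hγ0 : 0 ≤ γ) (hγ1 : γ < 1)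
    {μ : ℕ → S → ℝ} (hμ : ∀ t, IsPmf (μ t)) (s : S) : Summable fun t => γ ^ t * μ t s :=
  (summable_geometric_of_lt_one hγ0 hγ1).of_nonneg_of_le
    (fun t => mul_nonneg (pow_nonneg hγ0 t) ((hμ t).1 s))
    fun t => mul_le_of_le_one_right (pow_nonneg hγ0 t) ((hμ t).le_one s)

/-- Discounted mixtures of pmfs whose distance grows at most linearly in time. -/
theorem TV_tsum_geometric_mul_le {S : Type*} [Fintype S] {γ α : ℝ} (hγ0 : 0 ≤ γ) (hγ1 : γ < 1)
    {μ ν : ℕ → S → ℝ} (hμ : ∀ t, IsPmf (μ t)) (hν : ∀ t, IsPmf (ν t))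
    (h : ∀ t, TV (μ t) (ν t) ≤ t * α) :
    TV (fun s => (1 - γ) * ∑' t, γ ^ t * μ t s) (fun s => (1 - γ) * ∑' t, γ ^ t * ν t s) ≤
      γ * α / (1 - γ) := by
  have h1 : 0 < 1 - γ := sub_pos.2 hγ1
  have hsμ := IsPmf.summable_geometric_mul hγ0 hγ1 hμ
  have hsν := IsPmf.summable_geometric_mul hγ0 hγ1 hν
  have habs (s : S) : Summable fun t => γ ^ t * |μ t s - ν t s| :=
    ((hsμ s).sub (hsν s)).abs.congr fun t => by
      rw [← mul_sub, abs_mul, abs_of_nonneg (pow_nonneg hγ0 t)]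
  have hpoint (s : S) : |(1 - γ) * ∑' t, γ ^ t * μ t s - (1 - γ) * ∑' t, γ ^ t * ν t s| ≤
      (1 - γ) * ∑' t, γ ^ t * |μ t s - ν t s| := by
    rw [← mul_sub, abs_mul, abs_of_pos h1, ← (hsμ s).tsum_sub (hsν s)]
    refine mul_le_mul_of_nonneg_left ?_ h1.le
    rw [← Real.norm_eq_abs]
    refine tsum_of_norm_bounded (habs s).hasSum fun t => ?_
    rw [← mul_sub, Real.norm_eq_abs, abs_mul, abs_of_nonneg (pow_nonneg hγ0 t)]
  have hTV : HasSum (fun t => γ ^ t * TV (μ t) (ν t))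
      ((1 / 2) * ∑ s, ∑' t, γ ^ t * |μ t s - ν t s|) := by
    refine ((hasSum_sum fun s _ => (habs s).hasSum).mul_left (1 / 2)).congr_fun ?_
    intro t
    rw [TV, ← mul_sum, mul_left_comm]
  have hlin : HasSum (fun t : ℕ => t * γ ^ t * α) (γ / (1 - γ) ^ 2 * α) :=
    (hasSum_coe_mul_geometric_of_norm_lt_one
      (by rwa [Real.norm_eq_abs, abs_of_nonneg hγ0])).mul_right α
  calc TV (fun s => (1 - γ) * ∑' t, γ ^ t * μ t s) (fun s => (1 - γ) * ∑' t, γ ^ t * ν t s)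
      ≤ (1 / 2) * ∑ s, (1 - γ) * ∑' t, γ ^ t * |μ t s - ν t s| :=
        mul_le_mul_of_nonneg_left (sum_le_sum fun s _ => hpoint s) (by norm_num)
    _ = (1 - γ) * ((1 / 2) * ∑ s, ∑' t, γ ^ t * |μ t s - ν t s|) := by
        rw [← mul_sum, mul_left_comm]
    _ ≤ (1 - γ) * (γ / (1 - γ) ^ 2 * α) := by
        refine mul_le_mul_of_nonneg_left (hasSum_le (fun t => ?_) hTV hlin) h1.le
        calc γ ^ t * TV (μ t) (ν t) ≤ γ ^ t * (t * α) :=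
              mul_le_mul_of_nonneg_left (h t) (pow_nonneg hγ0 t)
          _ = t * γ ^ t * α := by ring
    _ = γ * α / (1 - γ) := by field_simp

/-- Error amplification bound: under an α-approximate dynamics model,
the discounted visitation distributions differ by at most `α/(1−γ)`. -/
theorem tv_error_amplification {S : Type*} [Fintype S] [Nonempty S]
    (γ α : ℝ) (hγ0 : 0 ≤ γ) (hγ1 : γ < 1) (hα : 0 ≤ α)
    (μ₀ : S → ℝ) (hμ₀ : IsPmf μ₀)
    (K Khat : S → S → ℝ) (hK : ∀ s, IsPmf (K s)) (hKhat : ∀ s, IsPmf (Khat s))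
    (hKK : ∀ s, TV (K s) (Khat s) ≤ α)
    (μ μhat : ℕ → S → ℝ)
    (hμ0 : μ 0 = μ₀) (hμhat0 : μhat 0 = μ₀)
    (hμstep : ∀ t s', μ (t + 1) s' = ∑ s, μ t s * K s s')
    (hμhatstep : ∀ t s', μhat (t + 1) s' = ∑ s, μhat t s * Khat s s')
    (ρ ρhat : S → ℝ)
    (hρ : ∀ s, ρ s = (1 - γ) * ∑' t : ℕ, γ ^ t * μ t s)
    (hρhat : ∀ s, ρhat s = (1 - γ) * ∑' t : ℕ, γ ^ t * μhat t s) :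
    TV ρ ρhat ≤ α / (1 - γ) := by
  have hμ (t : ℕ) : IsPmf (μ t) := by
    induction t with
    | zero => exact hμ0 ▸ hμ₀
    | succ t ih => exact funext (hμstep t) ▸ ih.sum_mul hK
  have hμhat (t : ℕ) : IsPmf (μhat t) := by
    induction t with
    | zero => exact hμhat0 ▸ hμ₀
    | succ t ih => exact funext (hμhatstep t) ▸ ih.sum_mul hKhat
  have hdist (t : ℕ) : TV (μ t) (μhat t) ≤ t * α := by
    induction t with
    | zero => simp [hμ0, hμhat0, TV]
    | succ t ih =>
      rw [funext (hμstep t), funext (hμhatstep t)]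
      push_cast
      linarith [TV_sum_mul_le (q := μhat t) (hμ t) hKhat hKK]
  rw [funext hρ, funext hρhat]
  refine (TV_tsum_geometric_mul_le hγ0 hγ1 hμ hμhat hdist).trans ?_
  exact div_le_div_of_nonneg_right (mul_le_of_le_one_left hα hγ1.le) (sub_pos.2 hγ1).le
end
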